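/- There exists a class C of r.e. subsets of ℕ with the following properties: (i) C is not BC* learnable; (ii) no single learner simultaneously weakly approximately (WeakApprox) learns C and partially (Part) learns C; (iii) C is approximately (Approx) learnable; (iv) C is consistently partially (ConsPart) learnable. -/

import Mathlib

open Filter

/-- The `e`-th partial recursive function in a fixed acceptable numbering. -/
def phi (e : ℕ) : ℕ →. ℕ := Nat.Partrec.Code.eval (Denumerable.ofNat Nat.Partrec.Code e)

/-- The `e`-th recursively enumerable set, `W_e = dom(φ_e)`. -/
def Wset (e : ℕ) : Set ℕ := (phi e).Dom

/-- `T` is a text for `L`: the natural numbers occurring in `T` are exactly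
the members of `L` (`none` plays the role of the pause symbol `#`). -/
def IsText (T : ℕ → Option ℕ) (L : Set ℕ) : Prop :=
  {x : ℕ | ∃ n, T n = some x} = L

/-- The finite sequence `T[n] = T(0), ..., T(n-1)`. -/
def pref (T : ℕ → Option ℕ) (n : ℕ) : List (Option ℕ) :=
  (List.range n).map T

/-- `M` partially (Part) learns `C`: on every text for every `L ∈ C` there is
exactly one index output infinitely often, and that index is an index of `L`. -/
def PartLearns (M : List (Option ℕ) → ℕ) (C : Set (Set ℕ)) : Prop :=
  ∀ L ∈ C, ∀ T : ℕ → Option ℕ, IsText T L →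
    ∃ e, {n | M (pref T n) = e}.Infinite ∧ Wset e = L ∧
      ∀ d, {n | M (pref T n) = d}.Infinite → d = e

/-- `M` is consistent (Cons): every number occurring in `σ` belongs to `W_{M(σ)}`. -/
def ConsLearner (M : List (Option ℕ) → ℕ) : Prop :=
  ∀ σ : List (Option ℕ), ∀ x : ℕ, some x ∈ σ → x ∈ Wset (M σ)

/-- `M` finitely approximately (FinApprox) learns `C`. -/
def FinApproxLearns (M : List (Option ℕ) → ℕ) (C : Set (Set ℕ)) : Prop :=
  ∀ L ∈ C, ∀ T : ℕ → Option ℕ, IsText T L → ∀ D : Finset ℕ,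
    ∀ᶠ n in atTop, Wset (M (pref T n)) ∩ ↑D = L ∩ ↑D

/-- `M` BC*-learns `C`: almost all hypotheses are finite variants of the target. -/
def BCstarLearns (M : List (Option ℕ) → ℕ) (C : Set (Set ℕ)) : Prop :=
  ∀ L ∈ C, ∀ T : ℕ → Option ℕ, IsText T L →
    ∀ᶠ n in atTop, (symmDiff (Wset (M (pref T n))) L).Finite

/-- `M` BC^k-learns `C`: almost all hypotheses differ from the target in at
most `k` elements. -/
def BCnLearns (k : ℕ) (M : List (Option ℕ) → ℕ) (C : Set (Set ℕ)) : Prop :=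
  ∀ L ∈ C, ∀ T : ℕ → Option ℕ, IsText T L →
    ∀ᶠ m in atTop, (symmDiff (Wset (M (pref T m))) L).Finite ∧
      (symmDiff (Wset (M (pref T m))) L).ncard ≤ k

/-- `M` behaviourally correctly (BC) learns `C`. -/
def BCLearns (M : List (Option ℕ) → ℕ) (C : Set (Set ℕ)) : Prop :=
  ∀ L ∈ C, ∀ T : ℕ → Option ℕ, IsText T L →
    ∀ᶠ n in atTop, Wset (M (pref T n)) = L

/-- `M` explanatorily (Ex) learns `C`. -/
def ExLearns (M : List (Option ℕ) → ℕ) (C : Set (Set ℕ)) : Prop :=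
  ∀ L ∈ C, ∀ T : ℕ → Option ℕ, IsText T L →
    ∃ e n₀, Wset e = L ∧ ∀ n ≥ n₀, M (pref T n) = e

/-- `M` weakly approximately (WeakApprox) learns `C`: for every text there is
an infinite set `W` such that on every finite variant `V` of `W` almost all
hypotheses agree with the target. -/
def WeakApproxLearns (M : List (Option ℕ) → ℕ) (C : Set (Set ℕ)) : Prop :=
  ∀ L ∈ C, ∀ T : ℕ → Option ℕ, IsText T L →
    ∃ W : Set ℕ, W.Infinite ∧ ∀ V : Set ℕ, (symmDiff V W).Finite →
      ∀ᶠ n in atTop, Wset (M (pref T n)) ∩ V = L ∩ V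

/-- `M` approximately (Approx) learns `C`: for every `L ∈ C` there is an
infinite set `W`, good for all texts for `L`. -/
def ApproxLearns (M : List (Option ℕ) → ℕ) (C : Set (Set ℕ)) : Prop :=
  ∀ L ∈ C, ∃ W : Set ℕ, W.Infinite ∧ ∀ T : ℕ → Option ℕ, IsText T L →
    ∀ V : Set ℕ, (symmDiff V W).Finite →
      ∀ᶠ n in atTop, Wset (M (pref T n)) ∩ V = L ∩ V

/-- Conservativeness for partial learners: on each text for every `L ∈ C`, `M`
outputs exactly one index `e` with `L ⊆ W_e`. -/
def ConsvLearner (M : List (Option ℕ) → ℕ) (C : Set (Set ℕ)) : Prop :=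
  ∀ L ∈ C, ∀ T : ℕ → Option ℕ, IsText T L →
    ∃! e, (∃ n, M (pref T n) = e) ∧ L ⊆ Wset e

/-- Confidence: on every infinite sequence, `M` outputs exactly one index
infinitely often. -/
def Confident (M : List (Option ℕ) → ℕ) : Prop :=
  ∀ T : ℕ → Option ℕ, ∃! e, {n | M (pref T n) = e}.Infinite

/-- The sets ever conjectured by `M` (used to express prudence). -/
def Conjectured (M : List (Option ℕ) → ℕ) : Set (Set ℕ) :=
  {S | ∃ σ : List (Option ℕ), S = Wset (M σ)}

open Nat.Partrec (Code)

/-! ### Indices and texts -/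

theorem mem_Wset {e x : ℕ} :
    x ∈ Wset e ↔ ∃ k, (Code.evaln k (Denumerable.ofNat Code e) x).isSome := by
  simp only [Wset, phi, PFun.mem_dom, Code.evaln_complete, Option.isSome_iff_exists]
  exact ⟨fun ⟨y, k, h⟩ => ⟨k, y, h⟩, fun ⟨k, y, h⟩ => ⟨y, k, h⟩⟩

/-- A uniformly decidable family of sets has a computable, injective family of indices. -/
theorem exists_injective_index {α : Type*} [Primcodable α] {p : α → ℕ → Bool}
    (hp : Computable₂ p) :
    ∃ f : α → ℕ, Computable f ∧ Function.Injective f ∧ ∀ a, Wset (f a) = {x | p a x = true} := by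
  have hF : Partrec fun q : α × ℕ => Nat.rfind fun _ => Part.some (p q.1 q.2) :=
    Partrec.rfind (hp.comp (Computable.fst.comp Computable.fst)
      (Computable.snd.comp Computable.fst)).partrec
  obtain ⟨c, hc⟩ := Code.exists_code.1 hF
  refine ⟨fun a => Encodable.encode (Code.curry c (Encodable.encode a)), ?_, ?_, ?_⟩
  · exact Computable.encode.comp
      ((Code.primrec₂_curry.comp (Primrec.const c) Primrec.encode).to_comp)
  · intro a b h
    exact Encodable.encode_injective (Code.curry_inj (Encodable.encode_injective h)).2
  · intro a
    ext x
    have : phi (Encodable.encode (Code.curry c (Encodable.encode a))) x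
        = (Nat.rfind fun _ => Part.some (p a x)).map Encodable.encode := by
      simp [phi, Code.eval_curry, hc]
    rw [Wset, PFun.mem_dom]
    simp only [this, Set.mem_ofPred_eq]
    rw [← Part.dom_iff_mem]
    refine (Nat.rfind_dom (p := fun _ => Part.some (p a x))).trans ?_
    simp

theorem pref_length (T : ℕ → Option ℕ) (n : ℕ) : (pref T n).length = n := by simp [pref]

theorem mem_pref {T : ℕ → Option ℕ} {n : ℕ} {o : Option ℕ} :
    o ∈ pref T n ↔ ∃ i < n, T i = o := by simp [pref]

theorem IsText.mem_of_mem_pref {T : ℕ → Option ℕ} {L : Set ℕ} (hT : IsText T L) {n x : ℕ}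
    (h : some x ∈ pref T n) : x ∈ L := by
  obtain ⟨i, -, hi⟩ := mem_pref.1 h
  rw [← hT]
  exact ⟨i, hi⟩

theorem IsText.eventually_mem_pref {T : ℕ → Option ℕ} {L : Set ℕ} (hT : IsText T L) {x : ℕ}
    (h : x ∈ L) : ∀ᶠ n in atTop, some x ∈ pref T n := by
  rw [← hT] at h
  obtain ⟨i, hi⟩ := h
  filter_upwards [eventually_gt_atTop i] with n hn
  exact mem_pref.2 ⟨i, hn, hi⟩

/-- The text entry that presents `j` if it belongs to `S` and pauses otherwise. -/
def item (S : Set ℕ) [DecidablePred (· ∈ S)] (j : ℕ) : Option ℕ := if j ∈ S then some j else none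

theorem item_eq_some {S : Set ℕ} [DecidablePred (· ∈ S)] {j x : ℕ} :
    item S j = some x ↔ j = x ∧ x ∈ S := by
  unfold item
  split_ifs with h
  · simp only [Option.some.injEq]
    exact ⟨fun hx => ⟨hx, hx ▸ h⟩, fun hx => hx.1⟩
  · simp only [false_iff]
    rintro ⟨rfl, hx⟩
    exact h hx

theorem some_mem_map_item {S : Set ℕ} [DecidablePred (· ∈ S)] {m x : ℕ} :
    some x ∈ (List.range m).map (item S) ↔ x < m ∧ x ∈ S := by
  simp only [List.mem_map, List.mem_range, item_eq_some]
  exact ⟨fun ⟨j, hj, e, h⟩ => ⟨e ▸ hj, h⟩, fun ⟨h, hx⟩ => ⟨x, h, rfl, hx⟩⟩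

/-- The text that starts with `l` and then enumerates `S` in increasing order. -/
def fillText (l : List (Option ℕ)) (S : Set ℕ) [DecidablePred (· ∈ S)] (i : ℕ) : Option ℕ :=
  if h : i < l.length then l[i] else item S (i - l.length)

theorem pref_fillText (l : List (Option ℕ)) (S : Set ℕ) [DecidablePred (· ∈ S)] (m : ℕ) :
    pref (fillText l S) (l.length + m) = l ++ (List.range m).map (item S) := by
  apply List.ext_getElem
  · simp [pref]
  · intro i h₁ h₂
    simp only [pref, List.getElem_map, List.getElem_range, fillText, List.getElem_append]

theorem isText_fillText {l : List (Option ℕ)} {S : Set ℕ} [DecidablePred (· ∈ S)]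
    (h : ∀ x, some x ∈ l → x ∈ S) : IsText (fillText l S) S := by
  ext x
  constructor
  · rintro ⟨i, hi⟩
    unfold fillText at hi
    split_ifs at hi with hl
    · exact h x (hi ▸ List.getElem_mem hl)
    · exact (item_eq_some.1 hi).2
  · intro hx
    refine ⟨l.length + x, ?_⟩
    simp [fillText, item, hx]

/-- An increasing chain of finite sequences is a chain of initial segments of one sequence. -/
theorem exists_pref_eq (l : ℕ → List (Option ℕ)) (hp : ∀ k, l k <+: l (k + 1))
    (hl : ∀ k, k ≤ (l k).length) : ∃ T : ℕ → Option ℕ, ∀ k, pref T (l k).length = l k := by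
  have mono : ∀ {j k}, j ≤ k → l j <+: l k := by
    intro j k h
    induction h with
    | refl => exact List.prefix_rfl
    | step _ ih => exact ih.trans (hp _)
  refine ⟨fun i => (l (i + 1))[i]'(hl (i + 1)), fun k => ?_⟩
  apply List.ext_getElem
  · simp [pref]
  · intro i h₁ h₂
    simp only [pref, List.getElem_map, List.getElem_range]
    rcases le_total (i + 1) k with h | h
    · exact (mono h).getElem _
    · exact ((mono h).getElem _).symm

/-! ### The class -/

/-- The numbers from `e` on that are below `n` or have parity `b`; no restriction if `2 ≤ b`. -/
def tagged (e n b : ℕ) : Set ℕ := {x | e ≤ x ∧ (x < n ∨ x % 2 = b ∨ 2 ≤ b)}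

instance (e n b : ℕ) : DecidablePred (· ∈ tagged e n b) :=
  fun x => inferInstanceAs (Decidable (e ≤ x ∧ (x < n ∨ x % 2 = b ∨ 2 ≤ b)))

theorem tagged_two (e n : ℕ) : tagged e n 2 = Set.Ici e := by
  ext x; simp [tagged]

/-- The part of the complement of `W_e` from `e` on. -/
def core (e : ℕ) : Set ℕ := {x | e ≤ x ∧ x ∉ Wset e}

/-- The sets `tagged e n b` with least element `e` that include an infinite `core e`. -/
def coreClass : Set (Set ℕ) :=
  {L | ∃ e n b, e < n ∧ L = tagged e n b ∧ (core e).Infinite ∧ core e ⊆ L}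

theorem Ici_mem_coreClass {e : ℕ} (h : (core e).Infinite) : Set.Ici e ∈ coreClass :=
  ⟨e, e + 1, 2, e.lt_succ_self, (tagged_two _ _).symm, h, fun _ hx => hx.1⟩

theorem primrecPred_tagged :
    PrimrecPred fun a : (ℕ × ℕ × ℕ) × ℕ => a.2 ∈ tagged a.1.1 a.1.2.1 a.1.2.2 := by
  have he : Primrec fun a : (ℕ × ℕ × ℕ) × ℕ => a.1.1 := Primrec.fst.comp Primrec.fst
  have hn : Primrec fun a : (ℕ × ℕ × ℕ) × ℕ => a.1.2.1 :=
    Primrec.fst.comp (Primrec.snd.comp Primrec.fst)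
  have hb : Primrec fun a : (ℕ × ℕ × ℕ) × ℕ => a.1.2.2 :=
    Primrec.snd.comp (Primrec.snd.comp Primrec.fst)
  exact (Primrec.nat_le.comp he Primrec.snd).and ((Primrec.nat_lt.comp Primrec.snd hn).or
    ((Primrec.eq.comp (Primrec.nat_mod.comp Primrec.snd (Primrec.const 2)) hb).or
      (Primrec.nat_le.comp (Primrec.const 2) hb)))

theorem exists_index_tagged :
    ∃ f : ℕ × ℕ × ℕ → ℕ, Computable f ∧ Function.Injective f ∧
      ∀ e n b, Wset (f (e, n, b)) = tagged e n b := by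
  obtain ⟨f, hf, hi, h⟩ := exists_injective_index
    (p := fun (a : ℕ × ℕ × ℕ) x => decide (x ∈ tagged a.1 a.2.1 a.2.2))
    primrecPred_tagged.decide.to_comp
  exact ⟨f, hf, hi, fun e n b => by simp [h]⟩


/-! ### The approximate learner -/

theorem findIdx_range_spec {n : ℕ} {p : ℕ → Bool} (h : (List.range n).findIdx p < n) :
    p ((List.range n).findIdx p) = true := by
  have hw : (List.range n).findIdx p < (List.range n).length := by rwa [List.length_range]
  have := List.findIdx_getElem (w := hw)
  rwa [List.getElem_range] at this

/-- The least number below the length of `σ` that occurs in `σ`, or that length if there is none. -/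
def minTag (σ : List (Option ℕ)) : ℕ := (List.range σ.length).findIdx fun x => some x ∈ σ

theorem minTag_le {σ : List (Option ℕ)} {x : ℕ} (h : some x ∈ σ) : minTag σ ≤ x := by
  unfold minTag
  rcases lt_or_ge x σ.length with hx | hx
  · by_contra! hlt
    have := List.not_of_lt_findIdx hlt
    simp [h] at this
  · refine List.findIdx_le_length.trans ?_
    simpa using hx

theorem minTag_eq {σ : List (Option ℕ)} {x : ℕ} (h : some x ∈ σ) (hx : x < σ.length)
    (hm : ∀ y, some y ∈ σ → x ≤ y) : minTag σ = x := by
  refine le_antisymm (minTag_le h) ?_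
  by_contra! hlt
  exact absurd (hm _ (of_decide_eq_true (findIdx_range_spec (hlt.trans hx)))) (not_le.2 hlt)

theorem IsText.eventually_minTag {T : ℕ → Option ℕ} {L : Set ℕ} (hT : IsText T L) {e : ℕ}
    (he : IsLeast L e) : ∀ᶠ n in atTop, minTag (pref T n) = e := by
  filter_upwards [hT.eventually_mem_pref he.1, eventually_gt_atTop e] with n h hn
  exact minTag_eq h (by rwa [pref_length]) fun y hy => he.2 (hT.mem_of_mem_pref hy)

theorem primrecRel_some_mem : PrimrecRel fun (σ : List (Option ℕ)) (x : ℕ) => some x ∈ σ := by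
  have : PrimrecRel fun (o : Option ℕ) (x : ℕ) => o = some x :=
    Primrec.eq.comp Primrec.fst (Primrec.option_some.comp Primrec.snd)
  exact (PrimrecRel.exists_mem_list this).of_eq fun p => by simp

theorem primrec_minTag : Primrec minTag :=
  Primrec.list_findIdx (Primrec.list_range.comp Primrec.list_length) primrecRel_some_mem.decide

theorem isLeast_tagged {e n b : ℕ} (h : e < n) : IsLeast (tagged e n b) e :=
  ⟨⟨le_rfl, Or.inl h⟩, fun _ hx => hx.1⟩

theorem exists_approxLearns_coreClass :
    ∃ M : List (Option ℕ) → ℕ, Computable M ∧ ApproxLearns M coreClass := by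
  obtain ⟨M, hM, -, hW⟩ := exists_injective_index
    (p := fun (σ : List (Option ℕ)) x => decide (some x ∈ σ ∨ (minTag σ ≤ x ∧
      Code.evaln σ.length (Denumerable.ofNat Code (minTag σ)) x = none))) (by
      have hm : Primrec fun q : List (Option ℕ) × ℕ => minTag q.1 :=
        primrec_minTag.comp Primrec.fst
      have hv : Primrec fun q : List (Option ℕ) × ℕ =>
          Code.evaln q.1.length (Denumerable.ofNat Code (minTag q.1)) q.2 :=
        Code.primrec_evaln.comp (((Primrec.list_length.comp Primrec.fst).pair
          ((Primrec.ofNat Code).comp hm)).pair Primrec.snd)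
      exact (PrimrecPred.decide ((primrecRel_some_mem.comp Primrec.fst Primrec.snd).or
        ((Primrec.nat_le.comp hm Primrec.snd).and
          (Primrec.eq.comp hv (Primrec.const none))))).to_comp)
  refine ⟨M, hM, ?_⟩
  rintro L ⟨e, n, b, hen, rfl, hinf, hsub⟩
  refine ⟨core e, hinf, fun T hT V hV => ?_⟩
  have key : ∀ x ∈ symmDiff V (core e), ∀ᶠ k in atTop,
      (x ∈ Wset (M (pref T k)) ↔ x ∈ tagged e n b) := by
    rintro x hx
    by_cases hxL : x ∈ tagged e n b
    · filter_upwards [hT.eventually_mem_pref hxL] with k hk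
      simp [hW, hk, hxL]
    · have hxc : x ∉ core e := fun h => hxL (hsub h)
      have hnot : ∀ k, some x ∉ pref T k := fun k hk => hxL (hT.mem_of_mem_pref hk)
      rcases lt_or_ge x e with hxe | hxe
      · filter_upwards [hT.eventually_minTag (isLeast_tagged hen)] with k hk
        simp [hW, hnot, hxL, hk, hxe]
      · have hxW : x ∈ Wset e := by
          by_contra h
          exact hxc ⟨hxe, h⟩
        obtain ⟨k₀, hk₀⟩ := mem_Wset.1 hxW
        obtain ⟨y, hy⟩ := Option.isSome_iff_exists.1 hk₀
        filter_upwards [hT.eventually_minTag (isLeast_tagged hen),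
          eventually_ge_atTop k₀] with k hk hkk
        have := Code.evaln_mono hkk hy
        rw [Option.mem_def] at this
        simp [hW, hnot, hxL, hk, pref_length, this]
  filter_upwards [hT.eventually_minTag (isLeast_tagged hen),
    (eventually_all_finite hV).2 key] with k hk hall
  ext x
  simp only [Set.mem_inter_iff, and_congr_left_iff]
  intro hxV
  by_cases hxc : x ∈ core e
  · refine iff_of_true ?_ (hsub hxc)
    have hn : Code.evaln k (Denumerable.ofNat Code e) x = none := by
      by_contra h
      exact hxc.2 (mem_Wset.2 ⟨k, Option.isSome_iff_ne_none.2 h⟩)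
    simp [hW, hk, pref_length, hn, hxc.1]
  · exact hall x (Or.inl ⟨hxV, hxc⟩)

/-! ### The consistent partial learner -/

/-- The least number from `minTag σ` on that is below the length of `σ` and does not occur in `σ`,
or that length if there is none. -/
def firstGap (σ : List (Option ℕ)) : ℕ :=
  (List.range σ.length).findIdx fun x => minTag σ ≤ x ∧ some x ∉ σ

theorem firstGap_spec {σ : List (Option ℕ)} (h : firstGap σ < σ.length) :
    minTag σ ≤ firstGap σ ∧ some (firstGap σ) ∉ σ :=
  of_decide_eq_true (findIdx_range_spec h)

theorem firstGap_eq {σ : List (Option ℕ)} {z : ℕ} (hz : z < σ.length) (hm : minTag σ ≤ z)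
    (hn : some z ∉ σ) (hlt : ∀ x, minTag σ ≤ x → x < z → some x ∈ σ) : firstGap σ = z := by
  have hle : firstGap σ ≤ z := by
    by_contra! h
    have := List.not_of_lt_findIdx h
    simp [hm, hn] at this
  refine hle.antisymm ?_
  by_contra! h
  have := firstGap_spec (h.trans hz)
  exact this.2 (hlt _ this.1 h)

theorem primrec_firstGap : Primrec firstGap :=
  Primrec.list_findIdx (Primrec.list_range.comp Primrec.list_length)
    (PrimrecPred.decide ((Primrec.nat_le.comp (primrec_minTag.comp Primrec.fst) Primrec.snd).and
      (primrecRel_some_mem.comp Primrec.fst Primrec.snd).not))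

/-- The largest number of parity `b` occurring in `σ`, or `0` if there is none. -/
def maxParity (b : ℕ) (σ : List (Option ℕ)) : ℕ :=
  σ.foldr (fun o r => if o.getD 0 % 2 = b then max (o.getD 0) r else r) 0

theorem le_maxParity {b x : ℕ} {σ : List (Option ℕ)} (h : some x ∈ σ) (hx : x % 2 = b) :
    x ≤ maxParity b σ := by
  induction σ with
  | nil => simp at h
  | cons o σ ih =>
    simp only [maxParity, List.foldr_cons] at ih ⊢
    rcases List.mem_cons.1 h with rfl | h
    · simp [hx]
    · have := ih h
      split_ifs <;> omega

theorem maxParity_le {b k : ℕ} {σ : List (Option ℕ)}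
    (h : ∀ x, some x ∈ σ → x % 2 = b → x ≤ k) : maxParity b σ ≤ k := by
  induction σ with
  | nil => simp [maxParity]
  | cons o σ ih =>
    have := ih fun x hx => h x (List.mem_cons_of_mem _ hx)
    simp only [maxParity, List.foldr_cons] at this ⊢
    split_ifs with ho
    · refine max_le ?_ this
      cases o with
      | none => simp
      | some x => exact h x List.mem_cons_self ho
    · exact this

theorem primrec_maxParity : Primrec₂ maxParity := by
  have ho : Primrec fun q : (ℕ × List (Option ℕ)) × Option ℕ × ℕ => q.2.1.getD 0 :=
    Primrec.option_getD.comp (Primrec.fst.comp Primrec.snd) (Primrec.const 0)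
  have hr : Primrec fun q : (ℕ × List (Option ℕ)) × Option ℕ × ℕ => q.2.2 :=
    Primrec.snd.comp Primrec.snd
  have hstep : Primrec₂ fun (q : ℕ × List (Option ℕ)) (s : Option ℕ × ℕ) =>
      if s.1.getD 0 % 2 = q.1 then max (s.1.getD 0) s.2 else s.2 :=
    Primrec.ite (Primrec.eq.comp (Primrec.nat_mod.comp ho (Primrec.const 2))
      (Primrec.fst.comp Primrec.fst)) (Primrec.nat_max.comp ho hr) hr
  exact Primrec.list_foldr Primrec.snd (Primrec.const 0) hstep

theorem dropLast_pref (T : ℕ → Option ℕ) (n : ℕ) : (pref T (n + 1)).dropLast = pref T n := by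
  simp [pref, List.range_succ]

/-- The parameters of the set `tagged` conjectured by the consistent partial learner. -/
def gapGuess (σ : List (Option ℕ)) : ℕ × ℕ × ℕ :=
  if firstGap σ = firstGap σ.dropLast then
    (minTag σ, maxParity (firstGap σ % 2) σ + 1, (firstGap σ + 1) % 2)
  else (minTag σ, 0, 2)

theorem primrec_gapGuess : Primrec gapGuess := by
  have hd : Primrec (List.dropLast : List (Option ℕ) → _) :=
    (Primrec.list_take.comp (Primrec.nat_sub.comp Primrec.list_length (Primrec.const 1))
      Primrec.id).of_eq fun σ => List.dropLast_eq_take.symm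
  have hg := primrec_firstGap
  exact Primrec.ite (Primrec.eq.comp hg (hg.comp hd))
    (primrec_minTag.pair ((Primrec.succ.comp (primrec_maxParity.comp
      (Primrec.nat_mod.comp hg (Primrec.const 2)) Primrec.id)).pair
      (Primrec.nat_mod.comp (Primrec.succ.comp hg) (Primrec.const 2))))
    (primrec_minTag.pair (Primrec.const (0, 2)))

theorem mem_tagged_gapGuess {σ : List (Option ℕ)} {x : ℕ} (h : some x ∈ σ) :
    x ∈ tagged (gapGuess σ).1 (gapGuess σ).2.1 (gapGuess σ).2.2 := by
  have hm := minTag_le h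
  unfold gapGuess
  split_ifs
  · refine ⟨hm, ?_⟩
    by_cases hx : x % 2 = firstGap σ % 2
    · exact Or.inl (Nat.lt_succ_of_le (le_maxParity h hx))
    · simp only
      omega
  · exact ⟨hm, by simp⟩

theorem IsText.frequently_gapGuess_Ici {T : ℕ → Option ℕ} {e : ℕ} (hT : IsText T (Set.Ici e)) :
    ∃ᶠ n in atTop, gapGuess (pref T n) = (e, 0, 2) := by
  intro hev
  have hleast : IsLeast (Set.Ici e) e := isLeast_Ici
  obtain ⟨N, hN⟩ := eventually_atTop.1 (hev.and (hT.eventually_minTag hleast))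
  have hstep : ∀ n ≥ N, firstGap (pref T (n + 1)) = firstGap (pref T n) := by
    intro n hn
    obtain ⟨h₁, h₂⟩ := hN (n + 1) (by omega)
    by_contra h
    exact h₁ (by simp [gapGuess, dropLast_pref, h, h₂])
  have hconst : ∀ n ≥ N, firstGap (pref T n) = firstGap (pref T N) := by
    intro n hn
    induction n, hn using Nat.le_induction with
    | base => rfl
    | succ n hn ih => rw [hstep n hn, ih]
  set z := firstGap (pref T N)
  have hz : ∀ᶠ n in atTop, e ≤ z → some z ∈ pref T n := by
    by_cases h : e ≤ z
    · filter_upwards [hT.eventually_mem_pref (x := z) h] with n hn _ using hn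
    · simp [h]
  obtain ⟨n, hn, hzn, hlt⟩ :=
    (hz.and ((eventually_gt_atTop z).and (eventually_ge_atTop N))).exists
  have hs := firstGap_spec (σ := pref T n) (by rw [hconst n hlt, pref_length]; exact hzn)
  rw [hconst n hlt, (hN n hlt).2] at hs
  exact hs.2 (hn hs.1)

theorem IsText.eventually_gapGuess_ne {T : ℕ → Option ℕ} {e : ℕ} (hT : IsText T (Set.Ici e))
    {d : ℕ × ℕ × ℕ} (hd : d ≠ (e, 0, 2)) : ∀ᶠ n in atTop, gapGuess (pref T n) ≠ d := by
  have h₁ := hT.eventually_mem_pref (x := e + d.2.1) (by simp)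
  have h₂ := hT.eventually_mem_pref (x := e + d.2.1 + 1) (by simp [add_assoc])
  filter_upwards [h₁, h₂, hT.eventually_minTag isLeast_Ici] with n h₁ h₂ hm h
  unfold gapGuess at h
  split_ifs at h
  · have hb := congrArg (fun q => q.2.1) h
    simp only at hb
    rcases Nat.mod_two_eq_zero_or_one (e + d.2.1 + firstGap (pref T n)) with hp | hp
    · have := le_maxParity (b := firstGap (pref T n) % 2) h₁ (by omega)
      omega
    · have := le_maxParity (b := firstGap (pref T n) % 2) h₂ (by omega)
      omega
  · exact hd (by rw [← h, hm])

theorem IsText.eventually_gapGuess {T : ℕ → Option ℕ} {e n b : ℕ} (hen : e < n)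
    (hT : IsText T (tagged e n b)) (hL : tagged e n b ≠ Set.Ici e) :
    ∃ d : ℕ × ℕ × ℕ, tagged d.1 d.2.1 d.2.2 = tagged e n b ∧
      ∀ᶠ k in atTop, gapGuess (pref T k) = d := by
  have hex : ∃ x, e ≤ x ∧ x ∉ tagged e n b := by
    by_contra! h
    exact hL (Set.Subset.antisymm (fun x hx => hx.1) h)
  classical
  let z := Nat.find hex
  obtain ⟨hez, hzL⟩ : e ≤ z ∧ z ∉ tagged e n b := Nat.find_spec hex
  have hzmin : ∀ x, e ≤ x → x < z → x ∈ tagged e n b := by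
    intro x hx hxz
    by_contra h
    exact Nat.find_min hex hxz ⟨hx, h⟩
  have hzb : n ≤ z ∧ z % 2 ≠ b ∧ b < 2 := by
    simp only [tagged, Set.mem_ofPred_eq, not_and, not_or, not_lt, not_le] at hzL
    exact hzL hez
  have hpre : ∀ᶠ k in atTop, ∀ x ∈ Set.Ico e z, some x ∈ pref T k :=
    (eventually_all_finite (Set.finite_Ico e z)).2 fun x hx =>
      hT.eventually_mem_pref (hzmin x hx.1 hx.2)
  have hmax : ∀ᶠ k in atTop, minTag (pref T k) = e ∧ firstGap (pref T k) = z ∧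
      ∀ x ∈ Set.Ico e z, some x ∈ pref T k := by
    filter_upwards [hpre, hT.eventually_minTag (isLeast_tagged hen),
      eventually_gt_atTop z] with k h hm hk
    refine ⟨hm, firstGap_eq (by rwa [pref_length]) (hm ▸ hez)
      (fun hz => hzL (hT.mem_of_mem_pref hz)) fun x hx hxz => h x ⟨hm ▸ hx, hxz⟩, h⟩
  obtain ⟨N, hN⟩ := eventually_atTop.1 hmax
  have hlt : ∀ {k x}, some x ∈ pref T k → x % 2 = z % 2 → x ∈ Set.Ico e n := by
    intro k x hx hxz
    have := hT.mem_of_mem_pref hx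
    simp only [tagged, Set.mem_ofPred_eq] at this
    simp only [Set.mem_Ico]
    omega
  have hle : ∀ j k, N ≤ k → maxParity (z % 2) (pref T j) ≤ maxParity (z % 2) (pref T k) := by
    intro j k hk
    refine maxParity_le fun x hx hxz => le_maxParity ?_ hxz
    have := hlt hx hxz
    exact (hN k hk).2.2 x ⟨this.1, this.2.trans_le hzb.1⟩
  have hmn : maxParity (z % 2) (pref T N) ≤ n - 1 :=
    maxParity_le fun x hx hxz => Nat.le_sub_one_of_lt (hlt hx hxz).2
  refine ⟨(e, maxParity (z % 2) (pref T N) + 1, (z + 1) % 2), ?_, ?_⟩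
  · ext x
    simp only [tagged, Set.mem_ofPred_eq]
    constructor
    · rintro ⟨hx, h⟩
      refine ⟨hx, ?_⟩
      omega
    · rintro ⟨hx, h⟩
      refine ⟨hx, ?_⟩
      by_cases hxz : x % 2 = z % 2
      · have := le_maxParity ((hN N le_rfl).2.2 x ⟨hx, by omega⟩) hxz
        omega
      · omega
  · filter_upwards [eventually_ge_atTop (N + 1)] with k hk
    obtain ⟨j, rfl⟩ : ∃ j, k = j + 1 := ⟨k - 1, by omega⟩
    obtain ⟨h₁, h₂, -⟩ := hN (j + 1) (by omega)
    have h₃ := (hN j (by omega)).2.1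
    simp [gapGuess, dropLast_pref, h₁, h₂, h₃,
      (hle (j + 1) N le_rfl).antisymm (hle N (j + 1) (by omega))]

theorem exists_consPartLearns_coreClass :
    ∃ M : List (Option ℕ) → ℕ, Computable M ∧ ConsLearner M ∧ PartLearns M coreClass := by
  obtain ⟨f, hf, hinj, hW⟩ := exists_index_tagged
  refine ⟨fun σ => f (gapGuess σ), hf.comp primrec_gapGuess.to_comp, ?_, ?_⟩
  · intro σ x hx
    have := mem_tagged_gapGuess hx
    rwa [← hW] at this
  · rintro L ⟨e, n, b, hen, rfl, -, -⟩ T hT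
    by_cases hL : tagged e n b = Set.Ici e
    · rw [hL] at hT ⊢
      refine ⟨f (e, 0, 2), ?_, by rw [hW, tagged_two], fun d hd => ?_⟩
      · refine Nat.frequently_atTop_iff_infinite.1 (hT.frequently_gapGuess_Ici.mono ?_)
        exact fun k hk => congrArg f hk
      · have hfreq := Nat.frequently_atTop_iff_infinite.2 hd
        obtain ⟨k, hk⟩ := hfreq.exists
        by_contra hne
        have hev := hT.eventually_gapGuess_ne (d := gapGuess (pref T k))
          fun h => hne (hk.symm.trans (congrArg f h))
        obtain ⟨j, hj, hj'⟩ := (hfreq.and_eventually hev).exists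
        exact hj' (hinj (hj.trans hk.symm))
    · obtain ⟨d, hd, hev⟩ := hT.eventually_gapGuess hen hL
      refine ⟨f d, ?_, (hW _ _ _).trans hd, fun d' hd' => ?_⟩
      · refine Nat.frequently_atTop_iff_infinite.1 (hev.mono fun k hk => ?_).frequently
        exact congrArg f hk
      · obtain ⟨k, hk, hk'⟩ :=
          ((Nat.frequently_atTop_iff_infinite.2 hd').and_eventually hev).exists
        exact hk.symm.trans (congrArg f hk')

/-! ### Failure of behaviourally correct learning with finitely many anomalies -/

theorem exists_core_eq_even :
    ∃ e, core e = {x | e ≤ x ∧ x % 2 = 0} := by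
  obtain ⟨f, -, -, hW⟩ := exists_injective_index (p := fun (_ : Unit) x => decide (x % 2 = 1))
    (PrimrecPred.decide (Primrec.eq.comp (Primrec.nat_mod.comp Primrec.snd (Primrec.const 2))
      (Primrec.const 1))).to_comp
  refine ⟨f (), ?_⟩
  ext x
  simp [core, hW]

theorem infinite_setOf_le_mod_two_eq (e : ℕ) {b : ℕ} (hb : b < 2) :
    {x | e ≤ x ∧ x % 2 = b}.Infinite := by
  refine Set.infinite_of_not_bddAbove ?_
  rintro ⟨B, hB⟩
  have := hB (a := 2 * (e + B + 1) + b) ⟨by omega, by omega⟩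
  omega

theorem not_exists_bcstarLearns_coreClass :
    ¬ ∃ M : List (Option ℕ) → ℕ, Computable M ∧ BCstarLearns M coreClass := by
  rintro ⟨M, -, hM⟩
  obtain ⟨e, he⟩ := exists_core_eq_even
  have hinf : (core e).Infinite := he ▸ infinite_setOf_le_mod_two_eq e two_pos
  have step : ∀ (l : {l : List (Option ℕ) // ∀ x, some x ∈ l → e ≤ x}) (k : ℕ),
      ∃ l' : {l : List (Option ℕ) // ∀ x, some x ∈ l → e ≤ x}, l.1 <+: l'.1 ∧
        k ≤ l'.1.length ∧ (∀ x, e ≤ x → x < k → some x ∈ l'.1) ∧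
        (Wset (M l'.1) ∩ {x | e ≤ x ∧ x % 2 = 1}).Finite := by
    rintro ⟨l, hl⟩ k
    obtain ⟨n, hen, hkn, hln⟩ : ∃ n, e < n ∧ k ≤ n ∧ ∀ x, some x ∈ l → x < n := by
      refine ⟨e + k + 1 + maxParity 0 l + maxParity 1 l, by omega, by omega, fun x hx => ?_⟩
      rcases Nat.mod_two_eq_zero_or_one x with h | h
      · have := le_maxParity hx h
        omega
      · have := le_maxParity hx h
        omega
    have hmem : tagged e n 0 ∈ coreClass :=
      ⟨e, n, 0, hen, rfl, hinf, fun x hx => by rw [he] at hx; exact ⟨hx.1, Or.inr (Or.inl hx.2)⟩⟩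
    have hT : IsText (fillText l (tagged e n 0)) (tagged e n 0) :=
      isText_fillText fun x hx => ⟨hl x hx, Or.inl (hln x hx)⟩
    obtain ⟨N, hN⟩ := eventually_atTop.1 (hM _ hmem _ hT)
    have hfin := hN (l.length + (n + N)) (by omega)
    rw [pref_fillText] at hfin
    refine ⟨⟨l ++ (List.range (n + N)).map (item (tagged e n 0)), fun x hx => ?_⟩,
      List.prefix_append _ _, ?_, fun x hex hxk => ?_, ?_⟩
    · rcases List.mem_append.1 hx with h | h
      · exact hl x h
      · exact (some_mem_map_item.1 h).2.1
    · simp only [List.length_append, List.length_map, List.length_range]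
      omega
    · exact List.mem_append_right _
        (some_mem_map_item.2 ⟨by omega, hex, Or.inl (by omega)⟩)
    · refine (hfin.union (Set.finite_Iio n)).subset ?_
      rintro x ⟨hx, hex, hodd⟩
      by_cases hxn : x < n
      · exact Or.inr hxn
      · refine Or.inl (Or.inl ⟨hx, fun h => ?_⟩)
        rcases h.2 with h | h | h <;> omega
  choose next hpre hlen hcov hfin using step
  let l : ℕ → {l : List (Option ℕ) // ∀ x, some x ∈ l → e ≤ x} :=
    fun k => Nat.rec ⟨[], by simp⟩ (fun k l => next l (k + 1)) k
  obtain ⟨T, hT⟩ := exists_pref_eq (fun k => (l k).1) (fun k => hpre (l k) (k + 1)) (by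
    rintro (_ | k)
    · exact Nat.zero_le _
    · exact hlen (l k) (k + 1))
  have htext : IsText T (Set.Ici e) := by
    ext x
    constructor
    · rintro ⟨i, hi⟩
      refine (l (i + 1)).2 x ?_
      rw [← hT (i + 1)]
      exact mem_pref.2 ⟨i, hlen (l i) (i + 1), hi⟩
    · intro hx
      have := hcov (l x) (x + 1) x hx x.lt_succ_self
      change some x ∈ (l (x + 1)).1 at this
      rw [← hT (x + 1)] at this
      obtain ⟨i, -, hi⟩ := mem_pref.1 this
      exact ⟨i, hi⟩
  obtain ⟨N, hN⟩ := eventually_atTop.1 (hM _ (Ici_mem_coreClass hinf) T htext)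
  have h₁ := hN _ ((Nat.le_succ N).trans (hlen (l N) (N + 1)))
  change (symmDiff (Wset (M (pref T (l (N + 1)).1.length))) _).Finite at h₁
  rw [hT (N + 1)] at h₁
  refine infinite_setOf_le_mod_two_eq e one_lt_two ((h₁.union (hfin (l N) (N + 1))).subset ?_)
  intro x hx
  by_cases hW : x ∈ Wset (M (l (N + 1)).1)
  · exact Or.inr ⟨hW, hx⟩
  · exact Or.inl (Or.inr ⟨hx.1, hW⟩)

/-! ### The diagonal construction

A history lists pairs `(g, t)`, the most recent one first. Each pair records how long the
enumeration of one parity class was continued, and the time needed to see that the learner's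
conjectures at all shorter continuations contain a large number of the other parity. -/

/-- A strict bound for the numbers presented by the sequence that belongs to a history. -/
def histBound (e : ℕ) (p : List (ℕ × ℕ)) : ℕ := e + 2 * Encodable.encode p + 2

/-- A code for a history; its parity is the one enumerated by the last block of the history. -/
def histCode (p : List (ℕ × ℕ)) : ℕ := 2 * Encodable.encode p + (p.length + 1) % 2

/-- The finite sequence that belongs to a history. -/
def histSeq (e : ℕ) : List (ℕ × ℕ) → List (Option ℕ)
  | [] => []
  | s :: p => histSeq e p ++
      (List.range (histBound e p + s.1)).map (item (tagged e (histBound e p) (p.length % 2)))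

/-- The sequence of `p` followed by a further block with parameter `g`. -/
def histExt (e : ℕ) (p : List (ℕ × ℕ)) (g : ℕ) : List (Option ℕ) := histSeq e ((g, 0) :: p)

theorem histSeq_cons (e : ℕ) (s : ℕ × ℕ) (p : List (ℕ × ℕ)) :
    histSeq e (s :: p) = histExt e p s.1 := rfl

theorem histExt_eq (e : ℕ) (p : List (ℕ × ℕ)) (g : ℕ) :
    histExt e p g = histSeq e p ++
      (List.range (histBound e p + g)).map (item (tagged e (histBound e p) (p.length % 2))) := rfl

theorem encode_hist_cons (s : ℕ × ℕ) (p : List (ℕ × ℕ)) :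
    Encodable.encode (s :: p) = (Nat.pair (Nat.pair s.1 s.2) (Encodable.encode p)).succ := rfl

theorem add_encode_lt_encode_cons (s : ℕ × ℕ) (p : List (ℕ × ℕ)) :
    s.1 + Encodable.encode p < Encodable.encode (s :: p) := by
  rw [encode_hist_cons]
  have h₁ := Nat.add_le_pair (Nat.pair s.1 s.2) (Encodable.encode p)
  have h₂ := Nat.left_le_pair s.1 s.2
  omega

theorem encode_hist_cons_le {s s' : ℕ × ℕ} (p : List (ℕ × ℕ)) (h₁ : s.1 ≤ s'.1)
    (h₂ : s.2 ≤ s'.2) : Encodable.encode (s :: p) ≤ Encodable.encode (s' :: p) := by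
  have left : ∀ {a b : ℕ} (c : ℕ), a ≤ b → Nat.pair a c ≤ Nat.pair b c := fun c h => by
    rcases h.eq_or_lt with rfl | h
    · rfl
    · exact (Nat.pair_lt_pair_left c h).le
  have right : ∀ {a b : ℕ} (c : ℕ), a ≤ b → Nat.pair c a ≤ Nat.pair c b := fun c h => by
    rcases h.eq_or_lt with rfl | h
    · rfl
    · exact (Nat.pair_lt_pair_right c h).le
  rw [encode_hist_cons, encode_hist_cons]
  exact Nat.succ_le_succ (left _ ((left _ h₁).trans (right _ h₂)))

theorem histBound_add_le (e : ℕ) (s : ℕ × ℕ) (p : List (ℕ × ℕ)) :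
    histBound e p + s.1 + 1 ≤ histBound e (s :: p) := by
  have := add_encode_lt_encode_cons s p
  unfold histBound
  omega

theorem histCode_lt_histBound (e : ℕ) {p p' : List (ℕ × ℕ)}
    (h : Encodable.encode p ≤ Encodable.encode p') : histCode p < histBound e p' := by
  unfold histCode histBound
  omega

theorem mem_histSeq {e x : ℕ} {p : List (ℕ × ℕ)} (h : some x ∈ histSeq e p) :
    e ≤ x ∧ x < histBound e p := by
  induction p with
  | nil => simp [histSeq] at h
  | cons s p ih =>
    have := histBound_add_le e s p
    rcases List.mem_append.1 h with h | h
    · have := ih h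
      omega
    · obtain ⟨h₁, h₂⟩ := some_mem_map_item.1 h
      exact ⟨h₂.1, by omega⟩

/-- `w` codes a number outside the set enumerated by the block after `p`, together with a time by
which it has been enumerated into the conjecture on `histExt e p g`. -/
def refutes (M : List (Option ℕ) → ℕ) (e : ℕ) (p : List (ℕ × ℕ)) (g w : ℕ) : Bool :=
  decide (histBound e p ≤ w.unpair.1 ∧ w.unpair.1 % 2 ≠ p.length % 2) &&
    (Code.evaln w.unpair.2 (Denumerable.ofNat Code (M (histExt e p g))) w.unpair.1).isSome

/-- By time `t`, all conjectures at continuations of `p` shorter than `g` have been refuted. -/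
def allRefuted (M : List (Option ℕ) → ℕ) (e : ℕ) (p : List (ℕ × ℕ)) (g t : ℕ) : Bool :=
  (List.range g).all fun g' => (List.range t).any fun w => refutes M e p g' w

/-- The pair `s = (g, t)` may extend `p`: `t` is the least time in `allRefuted`. -/
def isExtension (M : List (Option ℕ) → ℕ) (e : ℕ) (p : List (ℕ × ℕ)) (s : ℕ × ℕ) : Bool :=
  allRefuted M e p s.1 s.2 && (List.range s.2).all fun t => !allRefuted M e p s.1 t

/-- Every pair of the history extends the earlier ones, by a continuation that is never refuted. -/
def TruePath (M : List (Option ℕ) → ℕ) (e : ℕ) : List (ℕ × ℕ) → Prop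
  | [] => True
  | s :: q => isExtension M e q s = true ∧ (∀ w, refutes M e q s.1 w = false) ∧ TruePath M e q

/-- The codes of all one-step extensions of true histories. -/
def diagSet (M : List (Option ℕ) → ℕ) (e : ℕ) : Set ℕ :=
  {a | ∃ s q, a = histCode (s :: q) ∧ isExtension M e q s = true ∧ TruePath M e q}

section
variable {M : List (Option ℕ) → ℕ} {e : ℕ}

theorem exists_refutes_iff {p : List (ℕ × ℕ)} {g : ℕ} :
    (∃ w, refutes M e p g w = true) ↔
      ∃ x ∈ Wset (M (histExt e p g)), histBound e p ≤ x ∧ x % 2 ≠ p.length % 2 := by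
  constructor
  · rintro ⟨w, hw⟩
    simp only [refutes, Bool.and_eq_true, decide_eq_true_eq] at hw
    exact ⟨_, mem_Wset.2 ⟨_, hw.2⟩, hw.1⟩
  · rintro ⟨x, hx, h⟩
    obtain ⟨k, hk⟩ := mem_Wset.1 hx
    refine ⟨Nat.pair x k, ?_⟩
    simp only [refutes, Bool.and_eq_true, decide_eq_true_eq, Nat.unpair_pair]
    exact ⟨h, hk⟩

theorem allRefuted_iff {p : List (ℕ × ℕ)} {g t : ℕ} :
    allRefuted M e p g t = true ↔ ∀ g' < g, ∃ w < t, refutes M e p g' w = true := by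
  simp [allRefuted]

theorem isExtension_iff {p : List (ℕ × ℕ)} {s : ℕ × ℕ} :
    isExtension M e p s = true ↔
      allRefuted M e p s.1 s.2 = true ∧ ∀ t < s.2, ¬ allRefuted M e p s.1 t = true := by
  simp [isExtension]

theorem exists_isExtension {p : List (ℕ × ℕ)} {g : ℕ}
    (h : ∀ g' < g, ∃ w, refutes M e p g' w = true) : ∃ t, isExtension M e p (g, t) = true := by
  have hex : ∃ t, allRefuted M e p g t = true := by
    simp only [allRefuted_iff]
    refine Eventually.exists (f := atTop) ((eventually_all_finite (Set.finite_Iio g)).2 ?_)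
    intro g' hg'
    obtain ⟨w, hw⟩ := h g' hg'
    filter_upwards [eventually_gt_atTop w] with t ht using ⟨w, ht, hw⟩
  exact ⟨Nat.find hex, isExtension_iff.2 ⟨Nat.find_spec hex, fun t ht => Nat.find_min hex ht⟩⟩

theorem TruePath.le_of_isExtension {s s' : ℕ × ℕ} {q : List (ℕ × ℕ)} (h : TruePath M e (s :: q))
    (h' : isExtension M e q s' = true) : s'.1 ≤ s.1 ∧ s'.2 ≤ s.2 := by
  obtain ⟨h₁, h₂, -⟩ := h
  rw [isExtension_iff] at h₁ h'
  have hle : s'.1 ≤ s.1 := by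
    by_contra! hlt
    obtain ⟨w, -, hw⟩ := allRefuted_iff.1 h'.1 _ hlt
    simp [h₂ w] at hw
  refine ⟨hle, ?_⟩
  by_contra! hlt
  exact h'.2 _ hlt (allRefuted_iff.2 fun g hg => allRefuted_iff.1 h₁.1 g (hg.trans_le hle))

theorem TruePath.eq_of_length_eq {p q : List (ℕ × ℕ)} (hp : TruePath M e p) (hq : TruePath M e q)
    (h : p.length = q.length) : p = q := by
  induction p generalizing q with
  | nil => exact (List.length_eq_zero_iff.1 h.symm).symm
  | cons s p ih =>
    cases q with
    | nil => simp at h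
    | cons s' q =>
      obtain rfl := ih hp.2.2 hq.2.2 (by simpa using h)
      have h₁ := hp.le_of_isExtension hq.1
      have h₂ := hq.le_of_isExtension hp.1
      rw [Prod.ext (h₂.1.antisymm h₁.1) (h₂.2.antisymm h₁.2)]

theorem TruePath.histCode_lt {s : ℕ × ℕ} {p q : List (ℕ × ℕ)} (hp : TruePath M e p)
    (hs : isExtension M e p s = true) (hq : TruePath M e q) (h : p.length < q.length) :
    histCode (s :: p) < histBound e q := by
  induction q with
  | nil => simp at h
  | cons s' q ih =>
    rcases (Nat.lt_succ_iff.1 h).eq_or_lt with h | h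
    · obtain rfl := hp.eq_of_length_eq hq.2.2 h
      have := hq.le_of_isExtension hs
      exact histCode_lt_histBound e (encode_hist_cons_le p this.1 this.2)
    · have := histBound_add_le e s' q
      have := ih hq.2.2 h
      omega

theorem TruePath.exists_unrefuted {p q : List (ℕ × ℕ)} (hp : TruePath M e p)
    (hq : TruePath M e q) (h : p.length < q.length) : ∃ g, ∀ w, refutes M e p g w = false := by
  induction q with
  | nil => simp at h
  | cons s q ih =>
    rcases (Nat.lt_succ_iff.1 h).eq_or_lt with h | h
    · obtain rfl := hp.eq_of_length_eq hq.2.2 h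
      exact ⟨s.1, hq.2.1⟩
    · exact ih hq.2.2 h

theorem diagSet_subset_tagged {q : List (ℕ × ℕ)} (hq : TruePath M e q)
    (href : ∀ g, ∃ w, refutes M e q g w = true) {a : ℕ} (ha : a ∈ diagSet M e) (hea : e ≤ a) :
    a ∈ tagged e (histBound e q) (q.length % 2) := by
  refine ⟨hea, ?_⟩
  obtain ⟨s, p, rfl, hs, hp⟩ := ha
  rcases lt_trichotomy p.length q.length with h | h | h
  · exact Or.inl (hp.histCode_lt hs hq h)
  · obtain rfl := hp.eq_of_length_eq hq h
    refine Or.inr (Or.inl ?_)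
    simp only [histCode, List.length_cons]
    omega
  · obtain ⟨g, hg⟩ := hq.exists_unrefuted hp h
    obtain ⟨w, hw⟩ := href g
    simp [hg w] at hw

/-- A learner fails to partially learn the set enumerated after a true history all of whose
continuations are refuted. -/
theorem not_partLearns_of_forall_refuted (hcore : core e = {a | e ≤ a ∧ a ∈ diagSet M e})
    {q : List (ℕ × ℕ)} (hq : TruePath M e q) (href : ∀ g, ∃ w, refutes M e q g w = true) :
    ¬ PartLearns M coreClass := by
  intro hM
  set L := tagged e (histBound e q) (q.length % 2)
  have hinf : (core e).Infinite := by
    refine Set.infinite_of_not_bddAbove ?_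
    rintro ⟨B, hB⟩
    obtain ⟨t, ht⟩ := exists_isExtension (g := e + B + 1) fun g _ => href g
    have h₁ := add_encode_lt_encode_cons (e + B + 1, t) q
    have h₂ : e + B + 1 ≤ histCode ((e + B + 1, t) :: q) := by
      unfold histCode
      simp only at h₁
      omega
    have := @hB (histCode ((e + B + 1, t) :: q)) (by
      rw [hcore]
      exact ⟨by omega, _, _, rfl, ht, hq⟩)
    omega
  have hmem : L ∈ coreClass := by
    refine ⟨e, histBound e q, q.length % 2, by unfold histBound; omega, rfl, hinf, ?_⟩
    rw [hcore]
    exact fun a ha => diagSet_subset_tagged hq href ha.2 ha.1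
  have hT : IsText (fillText (histSeq e q) L) L :=
    isText_fillText fun x hx => ⟨(mem_histSeq hx).1, Or.inl (mem_histSeq hx).2⟩
  obtain ⟨d, hd, hW, -⟩ := hM L hmem _ hT
  obtain ⟨n, hn, hlt⟩ := hd.exists_gt ((histSeq e q).length + histBound e q)
  obtain ⟨g, rfl⟩ : ∃ g, n = (histSeq e q).length + (histBound e q + g) :=
    ⟨n - ((histSeq e q).length + histBound e q), by omega⟩
  rw [Set.mem_ofPred_eq, pref_fillText] at hn
  change M (histExt e q g) = d at hn
  obtain ⟨x, hx, hle, hpar⟩ := exists_refutes_iff.1 (href g)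
  rw [hn, hW] at hx
  rcases hx.2 with h | h | h <;> omega

/-- A learner fails to weakly approximately learn `Set.Ici e` if every true history has a
continuation that is never refuted. -/
theorem not_weakApproxLearns_of_forall_unrefuted
    (hcore : core e = {a | e ≤ a ∧ a ∈ diagSet M e})
    (hun : ∀ q, TruePath M e q → ∃ g, ∀ w, refutes M e q g w = false) :
    ¬ WeakApproxLearns M coreClass := by
  intro hM
  have step : ∀ q : {q // TruePath M e q}, ∃ s, TruePath M e (s :: q.1) := by
    rintro ⟨q, hq⟩
    classical
    obtain ⟨t, ht⟩ := exists_isExtension (M := M) (e := e) (p := q) (g := Nat.find (hun q hq))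
      fun g hg => by simpa using Nat.find_min (hun q hq) hg
    exact ⟨(_, t), ht, Nat.find_spec (hun q hq), hq⟩
  choose next hnext using step
  let h : ℕ → {q // TruePath M e q} :=
    fun k => Nat.rec ⟨[], trivial⟩ (fun _ q => ⟨next q :: q.1, hnext q⟩) k
  have hsucc : ∀ k, (h (k + 1)).1 = next (h k) :: (h k).1 := fun _ => rfl
  have hlen : ∀ k, (h k).1.length = k := by
    intro k
    induction k with
    | zero => rfl
    | succ k ih => rw [hsucc, List.length_cons, ih]
  have henc : ∀ k, k ≤ Encodable.encode (h k).1 := by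
    intro k
    induction k with
    | zero => exact Nat.zero_le _
    | succ k ih =>
      have := add_encode_lt_encode_cons (next (h k)) (h k).1
      rw [hsucc]
      omega
  have hinf : (core e).Infinite := by
    refine Set.infinite_of_not_bddAbove ?_
    rintro ⟨B, hB⟩
    have h₁ := henc (e + B + 1 + 1)
    have h₂ : e + B + 1 ≤ histCode (h (e + B + 1 + 1)).1 := by
      unfold histCode
      omega
    have := @hB (histCode (h (e + B + 1 + 1)).1) (by
      rw [hcore]
      exact ⟨by omega, _, _, rfl, (h (e + B + 1 + 1)).2.1, (h (e + B + 1)).2⟩)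
    omega
  have hseq : ∀ k, k ≤ (histSeq e (h k).1).length := by
    intro k
    induction k with
    | zero => exact Nat.zero_le _
    | succ k ih =>
      rw [hsucc, histSeq_cons, histExt_eq]
      simp only [List.length_append, List.length_map, List.length_range, histBound]
      omega
  obtain ⟨T, hT⟩ := exists_pref_eq (fun k => histSeq e (h k).1)
    (fun k => List.prefix_append _ _) hseq
  have htext : IsText T (Set.Ici e) := by
    ext x
    constructor
    · rintro ⟨i, hi⟩
      refine (mem_histSeq (p := (h (i + 1)).1) ?_).1
      rw [← hT (i + 1)]
      exact mem_pref.2 ⟨i, hseq (i + 1), hi⟩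
    · intro hx
      have hxb : x < histBound e (h x).1 := by
        have := henc x
        unfold histBound
        omega
      have : some x ∈ histSeq e (h (x + 1)).1 := by
        rw [hsucc, histSeq_cons, histExt_eq]
        exact List.mem_append_right _
          (some_mem_map_item.2 ⟨by omega, hx, Or.inl hxb⟩)
      rw [← hT (x + 1)] at this
      obtain ⟨i, -, hi⟩ := mem_pref.1 this
      exact ⟨i, hi⟩
  obtain ⟨W, hWinf, hW⟩ := hM _ (Ici_mem_coreClass hinf) T htext
  obtain ⟨N, hN⟩ := eventually_atTop.1 (hW W (by simp))
  obtain ⟨x, hxW, hx⟩ := hWinf.exists_gt (histBound e (h (N + 1)).1)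
  have hmono := histBound_add_le e (next (h N)) (h N).1
  rw [← hsucc] at hmono
  have hex : e ≤ x := by
    have : e ≤ histBound e (h (N + 1)).1 := by
      unfold histBound
      omega
    omega
  have parity : ∀ k, N ≤ k → histBound e (h k).1 ≤ x → x % 2 = k % 2 := by
    intro k hk hb
    by_contra hne
    have hmem : x ∈ Wset (M (histSeq e (h (k + 1)).1)) := by
      have hin : x ∈ Set.Ici e ∩ W := ⟨hex, hxW⟩
      rw [← hN (histSeq e (h (k + 1)).1).length (by have := hseq (k + 1); omega),
        hT (k + 1)] at hin
      exact hin.1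
    obtain ⟨w, hw⟩ := exists_refutes_iff.2 ⟨x, hmem, hb, by rwa [hlen]⟩
    simp [(h (k + 1)).2.2.1 w] at hw
  have h₁ := parity N le_rfl (by omega)
  have h₂ := parity (N + 1) (by omega) (by omega)
  omega

end

/-! ### Computability of the construction -/

theorem computable_all_range {α : Type*} [Primcodable α] {f : α → ℕ} {p : α → ℕ → Bool}
    (hf : Computable f) (hp : Computable₂ p) :
    Computable fun a => (List.range (f a)).all (p a) := by
  have hh : Computable₂ fun (a : α) (q : ℕ × Bool) => q.2 && p a q.1 :=
    (Primrec.and.to_comp).comp (Computable.snd.comp Computable.snd)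
      (hp.comp Computable.fst (Computable.fst.comp Computable.snd))
  refine (Computable.nat_rec hf (Computable.const true) hh).of_eq fun a => ?_
  induction f a with
  | zero => rfl
  | succ n ih => simp [List.range_succ, ih]

theorem computable_any_range {α : Type*} [Primcodable α] {f : α → ℕ} {p : α → ℕ → Bool}
    (hf : Computable f) (hp : Computable₂ p) :
    Computable fun a => (List.range (f a)).any (p a) := by
  have hnot : Computable₂ fun a k => !p a k := Primrec.not.to_comp.comp hp
  refine (Primrec.not.to_comp.comp (computable_all_range hf hnot)).of_eq fun a => ?_
  simp [List.not_all_eq_any_not]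

theorem primrec_histBound : Primrec₂ histBound :=
  Primrec.nat_add.comp (Primrec.nat_add.comp Primrec.fst
    (Primrec.nat_mul.comp (Primrec.const 2) (Primrec.encode.comp Primrec.snd))) (Primrec.const 2)

theorem primrec_histCode : Primrec histCode :=
  Primrec.nat_add.comp (Primrec.nat_mul.comp (Primrec.const 2) Primrec.encode)
    (Primrec.nat_mod.comp (Primrec.succ.comp Primrec.list_length) (Primrec.const 2))

theorem primrec_item_tagged :
    Primrec₂ fun (a : ℕ × ℕ × ℕ) (x : ℕ) => item (tagged a.1 a.2.1 a.2.2) x :=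
  Primrec.ite primrecPred_tagged (Primrec.option_some.comp Primrec.snd) (Primrec.const none)

theorem primrec_histSeq : Primrec₂ histSeq := by
  have hblock : Primrec fun q : ℕ × (ℕ × ℕ) × List (ℕ × ℕ) =>
      (List.range (histBound q.1 q.2.2 + q.2.1.1)).map
        (item (tagged q.1 (histBound q.1 q.2.2) (q.2.2.length % 2))) := by
    have hp : Primrec fun q : ℕ × (ℕ × ℕ) × List (ℕ × ℕ) => q.2.2 := Primrec.snd.comp Primrec.snd
    have hb : Primrec fun q : ℕ × (ℕ × ℕ) × List (ℕ × ℕ) => histBound q.1 q.2.2 :=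
      primrec_histBound.comp Primrec.fst hp
    have hitem : Primrec₂ fun (q : ℕ × (ℕ × ℕ) × List (ℕ × ℕ)) (x : ℕ) =>
        item (tagged q.1 (histBound q.1 q.2.2) (q.2.2.length % 2)) x :=
      primrec_item_tagged.comp ((Primrec.fst.pair (hb.pair (Primrec.nat_mod.comp
        (Primrec.list_length.comp hp) (Primrec.const 2)))).comp Primrec.fst) Primrec.snd
    exact Primrec.list_map (Primrec.list_range.comp (Primrec.nat_add.comp hb
      (Primrec.fst.comp (Primrec.fst.comp Primrec.snd)))) hitem
  have hstep : Primrec₂ fun (a : ℕ × List (ℕ × ℕ))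
      (r : (ℕ × ℕ) × List (ℕ × ℕ) × List (Option ℕ)) =>
      r.2.2 ++ (List.range (histBound a.1 r.2.1 + r.1.1)).map
        (item (tagged a.1 (histBound a.1 r.2.1) (r.2.1.length % 2))) :=
    Primrec.list_append.comp (Primrec.snd.comp (Primrec.snd.comp Primrec.snd))
      (hblock.comp ((Primrec.fst.comp Primrec.fst).pair ((Primrec.fst.comp Primrec.snd).pair
        (Primrec.fst.comp (Primrec.snd.comp Primrec.snd)))))
  refine (Primrec.list_rec Primrec.snd (Primrec.const []) hstep).of_eq ?_
  rintro ⟨e, p⟩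
  induction p with
  | nil => rfl
  | cons s p ih => exact congrArg (· ++ _) ih

section
variable {M : List (Option ℕ) → ℕ}

theorem computable_refutes (hM : Computable M) :
    Computable fun a : (ℕ × List (ℕ × ℕ)) × ℕ × ℕ => refutes M a.1.1 a.1.2 a.2.1 a.2.2 := by
  have he : Primrec fun a : (ℕ × List (ℕ × ℕ)) × ℕ × ℕ => a.1.1 := Primrec.fst.comp Primrec.fst
  have hp : Primrec fun a : (ℕ × List (ℕ × ℕ)) × ℕ × ℕ => a.1.2 := Primrec.snd.comp Primrec.fst
  have hg : Primrec fun a : (ℕ × List (ℕ × ℕ)) × ℕ × ℕ => a.2.1 := Primrec.fst.comp Primrec.snd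
  have hw : Primrec fun a : (ℕ × List (ℕ × ℕ)) × ℕ × ℕ => a.2.2.unpair :=
    Primrec.unpair.comp (Primrec.snd.comp Primrec.snd)
  have hx : Primrec fun a : (ℕ × List (ℕ × ℕ)) × ℕ × ℕ => a.2.2.unpair.1 := Primrec.fst.comp hw
  have hext : Primrec fun a : (ℕ × List (ℕ × ℕ)) × ℕ × ℕ => histExt a.1.1 a.1.2 a.2.1 :=
    primrec_histSeq.comp he (Primrec.list_cons.comp (hg.pair (Primrec.const 0)) hp)
  have hdec : Primrec fun a : (ℕ × List (ℕ × ℕ)) × ℕ × ℕ =>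
      decide (histBound a.1.1 a.1.2 ≤ a.2.2.unpair.1 ∧
        a.2.2.unpair.1 % 2 ≠ a.1.2.length % 2) :=
    PrimrecPred.decide ((Primrec.nat_le.comp (primrec_histBound.comp he hp) hx).and
      (Primrec.eq.comp (Primrec.nat_mod.comp hx (Primrec.const 2))
        (Primrec.nat_mod.comp (Primrec.list_length.comp hp) (Primrec.const 2))).not)
  have hcode : Computable fun a : (ℕ × List (ℕ × ℕ)) × ℕ × ℕ =>
      Denumerable.ofNat Code (M (histExt a.1.1 a.1.2 a.2.1)) :=
    (Computable.ofNat Code).comp (hM.comp hext.to_comp)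
  have hsome := Primrec.option_isSome.to_comp.comp
    (Code.primrec_evaln.to_comp.comp (((Primrec.snd.comp hw).to_comp.pair hcode).pair hx.to_comp))
  exact (Primrec.and.to_comp.comp hdec.to_comp hsome).of_eq fun _ => rfl

theorem computable_allRefuted (hM : Computable M) :
    Computable fun a : (ℕ × List (ℕ × ℕ)) × ℕ × ℕ => allRefuted M a.1.1 a.1.2 a.2.1 a.2.2 := by
  have hin : Computable₂ fun (b : ((ℕ × List (ℕ × ℕ)) × ℕ × ℕ) × ℕ) (w : ℕ) =>
      refutes M b.1.1.1 b.1.1.2 b.2 w := by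
    have hg : Computable fun c : (((ℕ × List (ℕ × ℕ)) × ℕ × ℕ) × ℕ) × ℕ =>
        (c.1.1.1, (c.1.2, c.2)) :=
      (Computable.fst.comp (Computable.fst.comp Computable.fst)).pair
        ((Computable.snd.comp Computable.fst).pair Computable.snd)
    exact ((computable_refutes hM).comp hg).of_eq fun _ => rfl
  have hany : Computable₂ fun (a : (ℕ × List (ℕ × ℕ)) × ℕ × ℕ) (g : ℕ) =>
      (List.range a.2.2).any fun w => refutes M a.1.1 a.1.2 g w := by
    have ht : Computable fun b : ((ℕ × List (ℕ × ℕ)) × ℕ × ℕ) × ℕ => b.1.2.2 :=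
      Computable.snd.comp (Computable.snd.comp Computable.fst)
    exact (computable_any_range ht hin).of_eq fun _ => rfl
  have hg : Computable fun a : (ℕ × List (ℕ × ℕ)) × ℕ × ℕ => a.2.1 :=
    Computable.fst.comp Computable.snd
  exact (computable_all_range hg hany).of_eq fun _ => rfl

theorem computable_isExtension (hM : Computable M) :
    Computable fun a : (ℕ × List (ℕ × ℕ)) × ℕ × ℕ => isExtension M a.1.1 a.1.2 a.2 := by
  have hin : Computable₂ fun (a : (ℕ × List (ℕ × ℕ)) × ℕ × ℕ) (t : ℕ) =>
      !allRefuted M a.1.1 a.1.2 a.2.1 t := by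
    have hg : Computable fun b : ((ℕ × List (ℕ × ℕ)) × ℕ × ℕ) × ℕ => (b.1.1, (b.1.2.1, b.2)) :=
      (Computable.fst.comp Computable.fst).pair
        ((Computable.fst.comp (Computable.snd.comp Computable.fst)).pair Computable.snd)
    exact (Primrec.not.to_comp.comp ((computable_allRefuted hM).comp hg)).of_eq fun _ => rfl
  have ht : Computable fun a : (ℕ × List (ℕ × ℕ)) × ℕ × ℕ => a.2.2 :=
    Computable.snd.comp Computable.snd
  exact (Primrec.and.to_comp.comp (computable_allRefuted hM)
    (computable_all_range ht hin)).of_eq fun _ => rfl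

/-- `(i, t)` witnesses that the history `p` is not a one-step extension of a true one. -/
def failsAt (M : List (Option ℕ) → ℕ) (e : ℕ) (p : List (ℕ × ℕ)) (i t : ℕ) : Bool :=
  decide (i < p.length) && (!isExtension M e (p.drop (i + 1)) (p.getD i (0, 0)) ||
    (decide (0 < i) && refutes M e (p.drop (i + 1)) (p.getD i (0, 0)).1 t))

/-- `w` witnesses that `a` does not belong to `diagSet M e`. -/
def outside (M : List (Option ℕ) → ℕ) (e a w : ℕ) : Bool :=
  decide (a ≠ histCode ((Encodable.decode (a / 2)).getD []) ∨
    ((Encodable.decode (a / 2)).getD [] : List (ℕ × ℕ)).length = 0) ||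
    failsAt M e ((Encodable.decode (a / 2)).getD []) w.unpair.1 w.unpair.2

theorem computable_failsAt (hM : Computable M) :
    Computable fun a : (ℕ × List (ℕ × ℕ)) × ℕ × ℕ => failsAt M a.1.1 a.1.2 a.2.1 a.2.2 := by
  have he : Primrec fun a : (ℕ × List (ℕ × ℕ)) × ℕ × ℕ => a.1.1 := Primrec.fst.comp Primrec.fst
  have hp : Primrec fun a : (ℕ × List (ℕ × ℕ)) × ℕ × ℕ => a.1.2 := Primrec.snd.comp Primrec.fst
  have hi : Primrec fun a : (ℕ × List (ℕ × ℕ)) × ℕ × ℕ => a.2.1 := Primrec.fst.comp Primrec.snd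
  have hs : Primrec fun a : (ℕ × List (ℕ × ℕ)) × ℕ × ℕ => a.1.2.getD a.2.1 (0, 0) :=
    (Primrec.list_getD (0, 0)).comp hp hi
  have hq : Primrec fun a : (ℕ × List (ℕ × ℕ)) × ℕ × ℕ => (a.1.1, a.1.2.drop (a.2.1 + 1)) :=
    he.pair (Primrec.list_drop.comp (Primrec.succ.comp hi) hp)
  have hlt : Primrec fun a : (ℕ × List (ℕ × ℕ)) × ℕ × ℕ => decide (a.2.1 < a.1.2.length) :=
    PrimrecPred.decide (Primrec.nat_lt.comp hi (Primrec.list_length.comp hp))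
  have hpos : Primrec fun a : (ℕ × List (ℕ × ℕ)) × ℕ × ℕ => decide (0 < a.2.1) :=
    PrimrecPred.decide (Primrec.nat_lt.comp (Primrec.const 0) hi)
  have hext := (computable_isExtension hM).comp (hq.pair hs).to_comp
  have href := (computable_refutes hM).comp
    (hq.pair ((Primrec.fst.comp hs).pair (Primrec.snd.comp Primrec.snd))).to_comp
  have hor := Primrec.or.to_comp.comp (Primrec.not.to_comp.comp hext)
    (Primrec.and.to_comp.comp hpos.to_comp href)
  exact (Primrec.and.to_comp.comp hlt.to_comp hor).of_eq fun _ => rfl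

theorem computable_outside (hM : Computable M) :
    Computable fun a : (ℕ × ℕ) × ℕ => outside M a.1.1 a.1.2 a.2 := by
  have ha : Primrec fun a : (ℕ × ℕ) × ℕ => a.1.2 := Primrec.snd.comp Primrec.fst
  have hw : Primrec fun a : (ℕ × ℕ) × ℕ => a.2.unpair := Primrec.unpair.comp Primrec.snd
  have hp : Primrec fun a : (ℕ × ℕ) × ℕ =>
      ((Encodable.decode (a.1.2 / 2)).getD [] : List (ℕ × ℕ)) :=
    Primrec.option_getD.comp (Primrec.decode.comp (Primrec.nat_div.comp ha (Primrec.const 2)))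
      (Primrec.const [])
  have hdec : Primrec fun a : (ℕ × ℕ) × ℕ =>
      decide (a.1.2 ≠ histCode ((Encodable.decode (a.1.2 / 2)).getD []) ∨
        ((Encodable.decode (a.1.2 / 2)).getD [] : List (ℕ × ℕ)).length = 0) :=
    PrimrecPred.decide ((Primrec.eq.comp ha (primrec_histCode.comp hp)).not.or
      (Primrec.eq.comp (Primrec.list_length.comp hp) (Primrec.const 0)))
  have hfail := (computable_failsAt hM).comp
    (((Primrec.fst.comp Primrec.fst).pair hp).pair hw).to_comp
  exact (Primrec.or.to_comp.comp hdec.to_comp hfail).of_eq fun _ => rfl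

theorem truePath_iff {e : ℕ} {p : List (ℕ × ℕ)} :
    TruePath M e p ↔ ∀ i < p.length, isExtension M e (p.drop (i + 1)) (p.getD i (0, 0)) = true ∧
      ∀ w, refutes M e (p.drop (i + 1)) (p.getD i (0, 0)).1 w = false := by
  induction p with
  | nil => simp [TruePath]
  | cons s p ih =>
    rw [TruePath, ih, List.length_cons, Nat.forall_lt_succ_left, and_assoc]
    simp

theorem exists_failsAt_cons_iff {e : ℕ} {s : ℕ × ℕ} {q : List (ℕ × ℕ)} :
    (∃ i t, failsAt M e (s :: q) i t = true) ↔
      ¬ (isExtension M e q s = true ∧ TruePath M e q) := by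
  have hzero : ∀ t, failsAt M e (s :: q) 0 t = true ↔ ¬ isExtension M e q s = true := by
    simp [failsAt]
  have hsucc : ∀ i t, failsAt M e (s :: q) (i + 1) t = true ↔ i < q.length ∧
      (¬ isExtension M e (q.drop (i + 1)) (q.getD i (0, 0)) = true ∨
        refutes M e (q.drop (i + 1)) (q.getD i (0, 0)).1 t = true) := by
    simp [failsAt]
  rw [truePath_iff]
  constructor
  · rintro ⟨_ | i, t, hit⟩ ⟨hs, h⟩
    · exact (hzero t).1 hit hs
    · obtain ⟨hi, hit⟩ := (hsucc i t).1 hit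
      obtain ⟨h₁, h₂⟩ := h i hi
      rcases hit with hit | hit
      · exact hit h₁
      · exact Bool.false_ne_true ((h₂ t).symm.trans hit)
  · intro h
    by_contra! hno
    refine h ⟨?_, fun i hi => ⟨?_, fun t => ?_⟩⟩
    · by_contra hs
      exact hno 0 0 ((hzero 0).2 hs)
    · by_contra hs
      exact hno (i + 1) 0 ((hsucc i 0).2 ⟨hi, Or.inl hs⟩)
    · rw [← Bool.not_eq_true]
      exact fun hs => hno (i + 1) t ((hsucc i t).2 ⟨hi, Or.inr hs⟩)

theorem exists_outside_iff {e a : ℕ} : (∃ w, outside M e a w = true) ↔ a ∉ diagSet M e := by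
  set p : List (ℕ × ℕ) := (Encodable.decode (a / 2)).getD [] with hp
  have hdecode : ∀ q, a = histCode q → p = q := by
    rintro q rfl
    have : histCode q / 2 = Encodable.encode q := by
      unfold histCode
      omega
    rw [hp, this, Encodable.encodek, Option.getD_some]
  have hsplit : (∃ w, outside M e a w = true) ↔
      (a ≠ histCode p ∨ p.length = 0) ∨ ∃ i t, failsAt M e p i t = true := by
    simp only [outside, Bool.or_eq_true, decide_eq_true_eq, ← hp, exists_or, exists_const]
    refine or_congr_right ⟨fun ⟨w, hw⟩ => ⟨_, _, hw⟩, fun ⟨i, t, h⟩ => ⟨Nat.pair i t, ?_⟩⟩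
    rwa [Nat.unpair_pair]
  rw [hsplit]
  by_cases ha : a = histCode p
  · cases hpq : p with
    | nil =>
      refine iff_of_true (by simp) ?_
      rintro ⟨s, q, h, -⟩
      have := hdecode _ h
      simp [hpq] at this
    | cons s q =>
      rw [exists_failsAt_cons_iff]
      rw [hpq] at ha
      simp only [ne_eq, ha, not_true_eq_false, List.length_cons, Nat.add_eq_zero_iff, one_ne_zero,
        and_false, or_self, false_or]
      refine not_congr ⟨fun h => ⟨s, q, rfl, h⟩, ?_⟩
      rintro ⟨s', q', h, h'⟩
      have := hdecode _ (ha.trans h)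
      rw [hpq] at this
      obtain ⟨rfl, rfl⟩ := List.cons.inj this
      exact h'
  · refine iff_of_true (Or.inl (Or.inl ha)) ?_
    rintro ⟨s, q, h, -⟩
    exact ha (by rw [hdecode _ h, h])

/-- The recursion theorem provides an index whose set is the complement of its own diagonal set. -/
theorem exists_core_eq_diagSet (hM : Computable M) :
    ∃ e, core e = {a | e ≤ a ∧ a ∈ diagSet M e} := by
  have hF : Partrec₂ fun (c : Code) (a : ℕ) =>
      Nat.rfind fun w => Part.some (outside M (Encodable.encode c) a w) := by
    have : Computable₂ fun (q : Code × ℕ) (w : ℕ) => outside M (Encodable.encode q.1) q.2 w := by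
      have hg : Computable fun b : (Code × ℕ) × ℕ => ((Encodable.encode b.1.1, b.1.2), b.2) :=
        ((Computable.encode.comp (Computable.fst.comp Computable.fst)).pair
          (Computable.snd.comp Computable.fst)).pair Computable.snd
      exact ((computable_outside hM).comp hg).of_eq fun _ => rfl
    exact Partrec.rfind this.partrec₂
  obtain ⟨c, hc⟩ := Code.fixed_point₂ hF
  refine ⟨Encodable.encode c, ?_⟩
  ext a
  refine and_congr_right fun _ => ?_
  rw [← not_iff_not, not_not, ← exists_outside_iff, Wset, PFun.mem_dom, ← Part.dom_iff_mem]
  simp only [phi, Denumerable.ofNat_encode, hc]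
  refine (Nat.rfind_dom (p := fun w => Part.some (outside M (Encodable.encode c) a w))).trans ?_
  simp

end

theorem not_exists_weakApprox_partLearns_coreClass :
    ¬ ∃ M : List (Option ℕ) → ℕ, Computable M ∧
      WeakApproxLearns M coreClass ∧ PartLearns M coreClass := by
  rintro ⟨M, hM, hweak, hpart⟩
  obtain ⟨e, he⟩ := exists_core_eq_diagSet hM
  by_cases h : ∃ q, TruePath M e q ∧ ∀ g, ∃ w, refutes M e q g w = true
  · obtain ⟨q, hq, href⟩ := h
    exact not_partLearns_of_forall_refuted he hq href hpart
  · refine not_weakApproxLearns_of_forall_unrefuted he (fun q hq => ?_) hweak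
    by_contra! hg
    exact h ⟨q, hq, fun g => by simpa using hg g⟩

/-- There is a class of r.e. sets which is (i) not BC* learnable, (ii) not
WeakApproxPart learnable, (iii) Approx learnable, and (iv) ConsPart
learnable. -/
theorem stmt16 :
    ∃ C : Set (Set ℕ), (∀ L ∈ C, ∃ e, Wset e = L) ∧
      (¬ ∃ M : List (Option ℕ) → ℕ, Computable M ∧ BCstarLearns M C) ∧
      (¬ ∃ M : List (Option ℕ) → ℕ, Computable M ∧
         WeakApproxLearns M C ∧ PartLearns M C) ∧
      (∃ M : List (Option ℕ) → ℕ, Computable M ∧ ApproxLearns M C) ∧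
      (∃ M : List (Option ℕ) → ℕ, Computable M ∧ ConsLearner M ∧
         PartLearns M C) := by
  refine ⟨coreClass, ?_, not_exists_bcstarLearns_coreClass,
    not_exists_weakApprox_partLearns_coreClass, exists_approxLearns_coreClass,
    exists_consPartLearns_coreClass⟩
  rintro L ⟨e, n, b, -, rfl, -, -⟩
  obtain ⟨f, -, -, hf⟩ := exists_index_tagged
  exact ⟨_, hf e n b⟩
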